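/- arXiv:2112.12999 — 2 statements merged into one kernel-verified Lean document; each statement's English description precedes it below -/
import Mathlib

section
/- (Closed-loop form in the IDA-PBC theorem.) Let n > m ≥ 1 and fix a point x ∈ ℝⁿ. Let a, b ∈ ℝⁿ denote a = (J(x) − R(x))∇H(x) and b = (J_d(x) − R_d(x))∇H_d(x), where H, H_d : ℝⁿ → ℝ are differentiable and J(x), R(x), J_d(x), R_d(x) ∈ Mat_{n×n}(ℝ). Let g(x) ∈ Mat_{n×m}(ℝ) have rank m and let g^⊥(x) ∈ Mat_{(n−m)×n}(ℝ) be a full-rank left annihilator of g(x). Assume the matching equation g^⊥(x)·b = g^⊥(x)·a holds, and define the feedback β(x) = (g(x)ᵀg(x))⁻¹ g(x)ᵀ (b − a). Then for every v ∈ ℝ^m, a + g(x)(β(x) + v) = b + g(x)v; in particular, with input u = β(x) + v the open-loop vector field (J(x) − R(x))∇H(x) + g(x)u equals the target vector field (J_d(x) − R_d(x))∇H_d(x) + g(x)v. -/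
open Matrix

/-- Gradient of a scalar function on `ι → ℝ` with respect to the standard basis. -/
noncomputable def grad {ι : Type*} [Fintype ι] [DecidableEq ι]
    (f : (ι → ℝ) → ℝ) (x : ι → ℝ) : ι → ℝ :=
  fun i => fderiv ℝ f x (Pi.single i 1)

/-- The kernel of a full-rank left annihilator of a full-rank matrix `g` is the range of `g`. -/
lemma range_mulVecLin_eq_ker_of_mul_eq_zero {K : Type*} [Field K] {n m k : ℕ}
    {g : Matrix (Fin n) (Fin m) K} {G : Matrix (Fin k) (Fin n) K}
    (hann : G * g = 0) (hrank : g.rank + G.rank = n) :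
    LinearMap.range g.mulVecLin = LinearMap.ker G.mulVecLin := by
  apply Submodule.eq_of_le_of_finrank_eq
  · rintro _ ⟨w, rfl⟩
    simp [hann]
  · have h := G.mulVecLin.finrank_range_add_finrank_ker
    rw [Module.finrank_fin_fun] at h
    unfold Matrix.rank at hrank
    omega

/-- The Gram matrix of a real matrix with full column rank is invertible. -/
lemma isUnit_det_transpose_mul_self {n m : ℕ} {g : Matrix (Fin n) (Fin m) ℝ}
    (hg : g.rank = m) : IsUnit (gᵀ * g).det := by
  rw [← Matrix.isUnit_iff_isUnit_det, ← Matrix.mulVec_surjective_iff_isUnit]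
  refine (LinearMap.range_eq_top (f := (gᵀ * g).mulVecLin)).mp ?_
  apply Submodule.eq_top_of_finrank_eq
  rw [Module.finrank_fin_fun]
  exact (Matrix.rank_transpose_mul_self g).trans hg

/-- Closed-loop form in the IDA-PBC theorem: under the matching equation, the IDA-PBC
feedback `β(x)` turns the open-loop vector field into the target vector field. -/
theorem stmt_4 {n m : ℕ} (hm : 1 ≤ m) (hmn : m < n)
    (x : Fin n → ℝ)
    (H Hd : (Fin n → ℝ) → ℝ) (hH : Differentiable ℝ H) (hHd : Differentiable ℝ Hd)
    (Jx Rx Jdx Rdx : Matrix (Fin n) (Fin n) ℝ)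
    (gx : Matrix (Fin n) (Fin m) ℝ) (hgx : gx.rank = m)
    (Gx : Matrix (Fin (n - m)) (Fin n) ℝ) (hGx : Gx.rank = n - m)
    (hann : Gx * gx = 0)
    (a b : Fin n → ℝ)
    (ha : a = (Jx - Rx) *ᵥ grad H x) (hb : b = (Jdx - Rdx) *ᵥ grad Hd x)
    (hmatch : Gx *ᵥ b = Gx *ᵥ a)
    (β : Fin m → ℝ) (hβ : β = ((gxᵀ * gx)⁻¹ * gxᵀ) *ᵥ (b - a)) :
    ∀ v : Fin m → ℝ, a + gx *ᵥ (β + v) = b + gx *ᵥ v := by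
  intro v
  have hker : b - a ∈ LinearMap.ker Gx.mulVecLin := by
    simp [Matrix.mulVec_sub, hmatch]
  rw [← range_mulVecLin_eq_ker_of_mul_eq_zero hann (by omega)] at hker
  obtain ⟨w, hw⟩ := hker
  rw [Matrix.mulVecLin_apply] at hw
  have hβw : β = w := by
    rw [hβ, ← hw, Matrix.mulVec_mulVec, Matrix.mul_assoc,
      Matrix.nonsing_inv_mul _ (isUnit_det_transpose_mul_self hgx), Matrix.one_mulVec]
  rw [hβw, Matrix.mulVec_add, hw]
  abel
end

section
/- (Stability part of the IDA-PBC theorem.) Let N ≥ 1 and let f : ℝ^N → ℝ^N be given by f(z) = (J_d(z) − R_d(z))∇H_d(z), where H_d : ℝ^N → ℝ is continuously differentiable and J_d(z) is skew-symmetric and R_d(z) is symmetric positive semidefinite for every z, with J_d, R_d continuous. Suppose x* ∈ ℝ^N is a strict local minimum of H_d, i.e., there is r > 0 with H_d(z) > H_d(x*) for all z with 0 < ‖z − x*‖ ≤ r, and ∇H_d(x*) = 0. Then x* is a Lyapunov stable equilibrium of ẋ = f(x): for every ε > 0 there exists δ > 0 such that every differentiable curve x : [0,∞) → ℝ^N satisfying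 ẋ(t) = f(x(t)) for all t ≥ 0 and ‖x(0) − x*‖ < δ satisfies ‖x(t) − x*‖ < ε for all t ≥ 0. -/
open Matrix

/-- The Fréchet derivative acts as the dot product with the gradient. -/
theorem fderiv_apply_eq_grad_dotProduct {ι : Type*} [Fintype ι] [DecidableEq ι]
    (f : (ι → ℝ) → ℝ) (x v : ι → ℝ) : fderiv ℝ f x v = grad f x ⬝ᵥ v := by
  conv_lhs => rw [pi_eq_sum_univ' v, map_sum]
  simp only [map_smul, smul_eq_mul, dotProduct, grad]
  exact Finset.sum_congr rfl fun i _ => mul_comm _ _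

/-- A skew-symmetric matrix has vanishing quadratic form. -/
theorem dotProduct_mulVec_self_eq_zero_of_transpose_eq_neg {ι : Type*} [Fintype ι]
    {A : Matrix ι ι ℝ} (hA : Aᵀ = -A) (v : ι → ℝ) : v ⬝ᵥ A *ᵥ v = 0 := by
  have h : v ⬝ᵥ A *ᵥ v = -(v ⬝ᵥ A *ᵥ v) := by
    conv_lhs => rw [dotProduct_mulVec, ← mulVec_transpose, hA, neg_mulVec, neg_dotProduct,
      dotProduct_comm]
  linarith

/-- The quadratic form of a skew-symmetric minus a positive semidefinite matrix is nonpositive. -/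
theorem dotProduct_sub_mulVec_self_nonpos {ι : Type*} [Fintype ι]
    {J R : Matrix ι ι ℝ} (hJ : Jᵀ = -J) (hR : R.PosSemidef) (v : ι → ℝ) :
    v ⬝ᵥ (J - R) *ᵥ v ≤ 0 := by
  have h := hR.dotProduct_mulVec_nonneg v
  rw [star_trivial] at h
  rw [sub_mulVec, dotProduct_sub, dotProduct_mulVec_self_eq_zero_of_transpose_eq_neg hJ]
  linarith

/-- A differentiable function with nonpositive derivative along a vector field is nonincreasing
along the forward solutions of that field. -/
theorem antitoneOn_comp_of_fderiv_nonpos {E : Type*} [NormedAddCommGroup E] [NormedSpace ℝ E]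
    {V : E → ℝ} (hV : Differentiable ℝ V) {f : E → E} (hVf : ∀ z, fderiv ℝ V z (f z) ≤ 0)
    {x : ℝ → E} (hx : ∀ t ∈ Set.Ici (0 : ℝ), HasDerivWithinAt x (f (x t)) (Set.Ici 0) t) :
    AntitoneOn (V ∘ x) (Set.Ici 0) := by
  have hd : ∀ t ∈ Set.Ici (0 : ℝ),
      HasDerivWithinAt (V ∘ x) (fderiv ℝ V (x t) (f (x t))) (Set.Ici 0) t := fun t ht =>
    (hV (x t)).hasFDerivAt.comp_hasDerivWithinAt t (hx t ht)
  exact antitoneOn_of_hasDerivWithinAt_nonpos (convex_Ici 0)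
    (fun t ht => (hd t ht).continuousWithinAt)
    (fun t ht => (hd t (interior_subset ht)).mono interior_subset) fun t _ => hVf (x t)

/-- **Lyapunov's stability theorem** for a continuous function with a strict local minimum at `a`,
nonincreasing along each curve of a family of continuous curves. -/
theorem exists_forall_norm_sub_lt_of_antitoneOn {E : Type*} [NormedAddCommGroup E]
    [NormedSpace ℝ E] [ProperSpace E] [Nontrivial E] {V : E → ℝ} (hV : Continuous V) {a : E}
    {r : ℝ} (hr : 0 < r) (hmin : ∀ z, 0 < ‖z - a‖ → ‖z - a‖ ≤ r → V a < V z)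
    {ε : ℝ} (hε : 0 < ε) :
    ∃ δ > 0, ∀ x : ℝ → E, ContinuousOn x (Set.Ici 0) → AntitoneOn (V ∘ x) (Set.Ici 0) →
      ‖x 0 - a‖ < δ → ∀ t ∈ Set.Ici (0 : ℝ), ‖x t - a‖ < ε := by
  have hρ : 0 < min ε r := lt_min hε hr
  obtain ⟨m, hm, hmle⟩ := (isCompact_sphere a (min ε r)).exists_isMinOn
    (NormedSpace.sphere_nonempty.2 hρ.le) hV.continuousOn
  rw [mem_sphere_iff_norm] at hm
  have ham : V a < V m := hmin m (hm ▸ hρ) (hm ▸ min_le_right _ _)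
  obtain ⟨δ, hδ, hball⟩ := Metric.eventually_nhds_iff.1 (hV.continuousAt.eventually_lt_const ham)
  refine ⟨min δ (min ε r), lt_min hδ hρ, fun x hxc hx hx0 t ht => ?_⟩
  by_contra! hle
  have hcont : ContinuousOn (fun s => ‖x s - a‖) (Set.Icc 0 t) :=
    ((hxc.mono Set.Icc_subset_Ici_self).sub continuousOn_const).norm
  obtain ⟨s, hs, hsρ⟩ := intermediate_value_Icc ht hcont
    ⟨(hx0.trans_le (min_le_right _ _)).le, (min_le_left _ _).trans hle⟩
  have hms : V m ≤ V (x s) := hmle (mem_sphere_iff_norm.2 hsρ)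
  have hs0 : V (x s) ≤ V (x 0) := hx Set.self_mem_Ici hs.1 hs.1
  have h0 : V (x 0) < V m := hball (by
    rw [dist_eq_norm]
    exact hx0.trans_le (min_le_left _ _))
  linarith

/-- Stability part of the IDA-PBC theorem: a strict local minimum of the desired
Hamiltonian is a Lyapunov stable equilibrium of the closed-loop dynamics. -/
theorem stmt_5 {N : ℕ} (hN : 1 ≤ N)
    (Hd : (Fin N → ℝ) → ℝ) (hHd : ContDiff ℝ 1 Hd)
    (Jd Rd : (Fin N → ℝ) → Matrix (Fin N) (Fin N) ℝ)
    (hJd : ∀ z, (Jd z)ᵀ = -(Jd z)) (hRd : ∀ z, (Rd z).PosSemidef)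
    (hJc : Continuous Jd) (hRc : Continuous Rd)
    (f : (Fin N → ℝ) → Fin N → ℝ)
    (hf : ∀ z, f z = (Jd z - Rd z) *ᵥ grad Hd z)
    (xstar : Fin N → ℝ) (hgrad : grad Hd xstar = 0)
    (r : ℝ) (hr : 0 < r)
    (hmin : ∀ z : Fin N → ℝ, 0 < ‖z - xstar‖ → ‖z - xstar‖ ≤ r → Hd xstar < Hd z) :
    ∀ ε > 0, ∃ δ > 0, ∀ x : ℝ → Fin N → ℝ,
      (∀ t ∈ Set.Ici (0 : ℝ), HasDerivWithinAt x (f (x t)) (Set.Ici 0) t) →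
      ‖x 0 - xstar‖ < δ → ∀ t ∈ Set.Ici (0 : ℝ), ‖x t - xstar‖ < ε := by
  intro ε hε
  have : Nonempty (Fin N) := ⟨⟨0, hN⟩⟩
  obtain ⟨δ, hδ, h⟩ := exists_forall_norm_sub_lt_of_antitoneOn hHd.continuous hr hmin hε
  refine ⟨δ, hδ, fun x hx => h x (fun t ht => (hx t ht).continuousWithinAt) ?_⟩
  refine antitoneOn_comp_of_fderiv_nonpos (hHd.differentiable one_ne_zero) (fun z => ?_) hx
  rw [fderiv_apply_eq_grad_dotProduct, hf]
  exact dotProduct_sub_mulVec_self_nonpos (hJd z) (hRd z) _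
end
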